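/- Let $\mu\in\mathbb R$, $d>0$, $t\in\mathbb R$, and let $\mathcal P(\mu,d)$ be the set of Borel probability measures $P$ on $\mathbb R$ with $\mathbb E_P[X]=\mu$ and $\mathbb E_P[|X-\mu|]=d$. Let $\psi_u:\mathbb R\to\mathbb R$ be concave and non-decreasing on each of $(-\infty,t)$ and $[t,\infty)$, and let $\psi_\ell:\mathbb R\to\mathbb R$ be convex and non-increasing on each of $(-\infty,t)$ and $[t,\infty)$. Assume that for every $P\in\mathcal P(\mu,d)$ the functions $\psi_u$ and $\psi_\ell$ are $P$-integrable and $\mathbb E_P[\psi_\ell(X)]>0$. Assume moreover that $\mathbb E_P[\psi_u(X)]\ge 0$ for at least one $P\in\mathcal P(\mu,d)$, or that $\psi_\ell$ is affine on each of $(-\infty,t)$ and $[t,\infty)$. For $v_1<\mu<v_2$ put $$g(v_1,v_2)=\frac{w_1\psi_u(v_1)+w_2\psi_u(v_2)}{w_1\psi_\ell(v_1)+w_2\psi_\ell(v_2)},\qquad w_2=\frac{\mu-v_1}{v_2-v_1},\quad w_1=1-w_2,$$ and assume: for every fixed $v_1<\mu-d/2$ the map $v_2\mapsto g(v_1,v_2)$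 is non-decreasing on $(\mu,\infty)$, and for every fixed $v_2>\mu+d/2$ the map $v_1\mapsto g(v_1,v_2)$ is non-increasing on $(-\infty,\mu)$. Then $$\sup_{P\in\mathcal P(\mu,d)}\frac{\mathbb E_P[\psi_u(X)]}{\mathbb E_P[\psi_\ell(X)]}=\sup\frac{w_1\psi_u(v_1)+w_2\psi_u(v_2)}{w_1\psi_\ell(v_1)+w_2\psi_\ell(v_2)}$$ as elements of $[-\infty,\infty]$, where the right-hand supremum is over all two-point distributions $w_1\delta_{v_1}+w_2\delta_{v_2}\in\mathcal P(\mu,d)$ with $w_1,w_2\ge 0$, $w_1+w_2=1$, $v_1<\mu-d/2$ and $v_2>\mu+d/2$. -/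

import Mathlib

open MeasureTheory

/-- The two-point distribution `w1 δ_{v1} + w2 δ_{v2}` with data `(v1, w1, v2, w2)`. -/
noncomputable def twoPoint (v1 w1 v2 w2 : ℝ) : Measure ℝ :=
  (ENNReal.ofReal w1) • Measure.dirac v1 + (ENNReal.ofReal w2) • Measure.dirac v2

/-- The mean-MAD ambiguity set `P(μ,d)`: Borel probability measures on `ℝ` with mean `μ` and
mean absolute deviation `d`. -/
def madSet (μ d : ℝ) : Set (Measure ℝ) :=
  {P | IsProbabilityMeasure P ∧ Integrable (fun x : ℝ => x) P ∧ (∫ x, x ∂P) = μ ∧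
    (∫ x, |x - μ| ∂P) = d}

/-- The two-point objective `g(v1,v2)`, with `w2 = (μ - v1) / (v2 - v1)` and `w1 = 1 - w2`. -/
noncomputable def gfun (μ : ℝ) (ψu ψl : ℝ → ℝ) (v1 v2 : ℝ) : ℝ :=
  ((1 - (μ - v1) / (v2 - v1)) * ψu v1 + ((μ - v1) / (v2 - v1)) * ψu v2) /
  ((1 - (μ - v1) / (v2 - v1)) * ψl v1 + ((μ - v1) / (v2 - v1)) * ψl v2)

/-- `f` agrees on `s` with an affine function. -/
def IsAffineOn (f : ℝ → ℝ) (s : Set ℝ) : Prop :=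
  ∃ m c : ℝ, ∀ x ∈ s, f x = m * x + c

/-- A concave function on a set of reals has a supporting line at every interior point. -/
lemma ConcaveOn.exists_supporting_line {s : Set ℝ} {f : ℝ → ℝ} (hf : ConcaveOn ℝ s f) {m : ℝ}
    (hm : m ∈ interior s) : ∃ k : ℝ, ∀ x ∈ s, f x ≤ f m + k * (x - m) := by
  have hg : ConvexOn ℝ s (-f) := hf.neg
  have hms := interior_subset hm
  refine ⟨-derivWithin (-f) (Set.Ioi m) m, fun x hx => ?_⟩
  rcases lt_trichotomy x m with h | h | h
  · have h1 := (hg.slope_le_leftDeriv_of_mem_interior hx hm h).trans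
      (hg.leftDeriv_le_rightDeriv_of_mem_interior hm)
    rw [slope_def_field, div_le_iff₀ (sub_pos.2 h)] at h1
    simp only [Pi.neg_apply] at h1
    linarith
  · simp [h]
  · have h1 := hg.rightDeriv_le_slope_of_mem_interior hm hx h
    rw [slope_def_field, le_div_iff₀ (sub_pos.2 h)] at h1
    simp only [Pi.neg_apply] at h1
    linarith

/-- Jensen's inequality on a piece `A` with barycenter `m`, without any continuity assumption. -/
lemma ConcaveOn.setIntegral_le_measureReal_mul {P : Measure ℝ} [IsFiniteMeasure P] {s A : Set ℝ}
    {f : ℝ → ℝ} {m : ℝ} (hf : ConcaveOn ℝ s f) (hA : ∀ᵐ x ∂(P.restrict A), x ∈ s)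
    (hx : IntegrableOn (fun x : ℝ => x) A P) (hfi : IntegrableOn f A P)
    (hmean : ∫ x in A, x ∂P = P.real A * m) (hm : m ∈ interior s ∨ IsLeast s m) :
    ∫ x in A, f x ∂P ≤ P.real A * f m := by
  have hxm : IntegrableOn (fun x : ℝ => x - m) A P := hx.sub (integrable_const m)
  have hzero : ∫ x in A, (x - m) ∂P = 0 := by
    rw [integral_sub hx (integrable_const m), hmean]
    simp
  rcases hm with hm | hm
  · obtain ⟨k, hk⟩ := hf.exists_supporting_line hm
    calc ∫ x in A, f x ∂P ≤ ∫ x in A, (f m + k * (x - m)) ∂P := by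
          refine integral_mono_ae hfi ((integrable_const _).add (hxm.const_mul k)) ?_
          filter_upwards [hA] with x hx using hk x hx
      _ = P.real A * f m := by
          rw [integral_add (integrable_const _) (hxm.const_mul k), integral_const_mul, hzero]
          simp
  · have h0 : 0 ≤ᵐ[P.restrict A] fun x : ℝ => x - m := by
      filter_upwards [hA] with x hx using sub_nonneg.2 (hm.2 hx)
    have h1 := (integral_eq_zero_iff_of_nonneg_ae h0 hxm).1 hzero
    have h2 : ∫ x in A, f x ∂P = ∫ x in A, f m ∂P := by
      refine integral_congr_ae ?_
      filter_upwards [h1] with x hx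
      rw [sub_eq_zero.1 hx]
    rw [h2]
    simp

/-- If `N / D` is nondecreasing, with `N` concave and `D` convex, then passing from `x₀` to a point
`x₁` with `0 < D x₁` does not decrease the quotient, even when `D x₀ ≤ 0`. -/
lemma div_le_div_of_monotoneOn {N D : ℝ → ℝ} {x₀ x₁ A B : ℝ}
    (hN : ConcaveOn ℝ (Set.Ioi 0) N) (hD : ConvexOn ℝ (Set.Ioi 0) D)
    (hmono : MonotoneOn (fun x => N x / D x) (Set.Ioi 0)) (hx₀ : 0 < x₀) (hx : x₀ ≤ x₁)
    (hD₁ : 0 < D x₁) (hA : A ≤ N x₀) (hB : D x₀ ≤ B) (hB0 : 0 < B) (hsign : 0 ≤ A ∨ D x₀ = B) :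
    A / B ≤ N x₁ / D x₁ := by
  have hmem : ∀ x, x₀ ≤ x → x ∈ Set.Ioi (0 : ℝ) := fun x h => hx₀.trans_le h
  rcases lt_or_ge 0 (D x₀) with hD₀ | hD₀
  · refine le_trans ?_ (hmono (hmem _ le_rfl) (hmem _ hx) hx)
    change A / B ≤ N x₀ / D x₀
    rcases hsign with h | h
    · exact div_le_div₀ (h.trans hA) hA hD₀ hB
    · rw [h]; gcongr
  have hA0 : 0 ≤ A := by
    rcases hsign with h | h
    · exact h
    · linarith
  have hNc : ContinuousOn N (Set.Ioi 0) := hN.continuousOn isOpen_Ioi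
  have hDc : ContinuousOn D (Set.Ioi 0) := hD.continuousOn isOpen_Ioi
  have hsub : Set.Icc x₀ x₁ ⊆ Set.Ioi 0 := fun x h => hmem x h.1
  have hcl : IsClosed (Set.Icc x₀ x₁ ∩ D ⁻¹' Set.Iic 0) :=
    (hDc.mono hsub).preimage_isClosed_of_isClosed isClosed_Icc isClosed_Iic
  have hcomp : IsCompact (Set.Icc x₀ x₁ ∩ D ⁻¹' Set.Iic 0) :=
    isCompact_Icc.of_isClosed_subset hcl Set.inter_subset_left
  obtain ⟨s, ⟨⟨hs0, hs1⟩, hsD⟩, hsmax⟩ :=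
    hcomp.exists_isGreatest ⟨x₀, ⟨le_rfl, hx⟩, hD₀⟩
  have hsD : D s ≤ 0 := hsD
  have hs1 : s < x₁ := lt_of_le_of_ne hs1 (by rintro rfl; linarith)
  have hpos : ∀ x ∈ Set.Ioc s x₁, 0 < D x := by
    intro x hx
    by_contra! h
    exact absurd (hsmax ⟨⟨hs0.trans hx.1.le, hx.2⟩, h⟩) (not_le.2 hx.1)
  have hev : ∀ᶠ x in nhdsWithin s (Set.Ioi s), x ∈ Set.Ioc s x₁ := Ioc_mem_nhdsGT hs1
  have hcont : ∀ F : ℝ → ℝ, ContinuousOn F (Set.Ioi 0) →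
      Filter.Tendsto F (nhdsWithin s (Set.Ioi s)) (nhds (F s)) := fun F hF =>
    ((hF.continuousAt (isOpen_Ioi.mem_nhds (hmem s hs0))).tendsto).mono_left nhdsWithin_le_nhds
  have hsD0 : D s = 0 := by
    refine le_antisymm hsD (ge_of_tendsto (hcont D hDc) ?_)
    filter_upwards [hev] with x hx using (hpos x hx).le
  have hgs : 0 ≤ N x₁ / D x₁ := by
    have := hmono (hmem s hs0) (hmem _ hx) hs1.le
    simpa [hsD0] using this
  have hNs : N s ≤ 0 := by
    have hlim : N s ≤ N x₁ / D x₁ * D s := by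
      refine le_of_tendsto_of_tendsto (hcont N hNc) ((hcont D hDc).const_mul _) ?_
      filter_upwards [hev] with x hx
      have := hmono (hmem x (hs0.trans hx.1.le)) (hmem _ (hs0.trans hs1.le)) hx.2
      exact (div_le_iff₀ (hpos x hx)).1 this
    simpa [hsD0] using hlim
  have hN₁ : 0 ≤ N x₁ := by
    by_contra! h
    exact absurd hgs (not_le.2 (div_neg_of_neg_of_pos h hD₁))
  have hlt : 0 < x₁ - x₀ := by linarith
  have hcomb := hN.2 (hmem x₀ le_rfl) (hmem x₁ hx)
    (show 0 ≤ (x₁ - s) / (x₁ - x₀) from div_nonneg (by linarith) hlt.le)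
    (show 0 ≤ (s - x₀) / (x₁ - x₀) from div_nonneg (by linarith) hlt.le)
    (by field_simp; ring)
  have hse : (x₁ - s) / (x₁ - x₀) * x₀ + (s - x₀) / (x₁ - x₀) * x₁ = s := by
    field_simp; ring
  simp only [smul_eq_mul] at hcomb
  rw [hse] at hcomb
  have h1 : 0 < (x₁ - s) / (x₁ - x₀) := div_pos (by linarith) hlt
  have h2 : 0 ≤ (s - x₀) / (x₁ - x₀) * N x₁ :=
    mul_nonneg (div_nonneg (by linarith) hlt.le) hN₁
  have hN₀ : N x₀ ≤ 0 := by
    by_contra! h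
    have := mul_pos h1 h
    linarith
  exact (div_nonpos_of_nonpos_of_nonneg (hA.trans hN₀) hB0.le).trans hgs

lemma integrable_twoPoint (f : ℝ → ℝ) (v1 w1 v2 w2 : ℝ) :
    Integrable f (twoPoint v1 w1 v2 w2) :=
  ((integrable_dirac (by simp)).smul_measure ENNReal.ofReal_ne_top).add_measure
    ((integrable_dirac (by simp)).smul_measure ENNReal.ofReal_ne_top)

lemma integral_twoPoint (f : ℝ → ℝ) {v1 w1 v2 w2 : ℝ} (h1 : 0 ≤ w1) (h2 : 0 ≤ w2) :
    ∫ x, f x ∂(twoPoint v1 w1 v2 w2) = w1 * f v1 + w2 * f v2 := by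
  unfold twoPoint
  rw [integral_add_measure ((integrable_dirac (by simp)).smul_measure ENNReal.ofReal_ne_top)
    ((integrable_dirac (by simp)).smul_measure ENNReal.ofReal_ne_top)]
  simp [integral_smul_measure, ENNReal.toReal_ofReal, h1, h2]

lemma twoPoint_mem_madSet {μ d v1 w1 v2 w2 : ℝ} (h1 : 0 ≤ w1) (h2 : 0 ≤ w2) (hw : w1 + w2 = 1)
    (hv1 : v1 ≤ μ) (hv2 : μ ≤ v2) (hmean : w1 * v1 + w2 * v2 = μ) (hd : w2 * (v2 - μ) = d / 2) :
    twoPoint v1 w1 v2 w2 ∈ madSet μ d := by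
  refine ⟨⟨?_⟩, integrable_twoPoint _ _ _ _ _, ?_, ?_⟩
  · simp [twoPoint, ← ENNReal.ofReal_add h1 h2, hw]
  · rw [integral_twoPoint (fun x => x) h1 h2, hmean]
  · rw [integral_twoPoint (fun x => |x - μ|) h1 h2, abs_of_nonpos (by linarith),
      abs_of_nonneg (by linarith)]
    linear_combination 2 * hd - hmean + μ * hw

lemma setIntegral_pos_of_ae {P : Measure ℝ} [IsFiniteMeasure P] {A : Set ℝ} {f : ℝ → ℝ}
    (hA : 0 < P.real A) (hf : ∀ᵐ x ∂(P.restrict A), 0 < f x) (hfi : IntegrableOn f A P) :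
    0 < ∫ x in A, f x ∂P := by
  have h0 : 0 ≤ᵐ[P.restrict A] f := by filter_upwards [hf] with x hx using hx.le
  refine lt_of_le_of_ne (integral_nonneg_of_ae h0) fun h => ?_
  have h1 := (integral_eq_zero_iff_of_nonneg_ae h0 hfi).1 h.symm
  have h2 : ∀ᵐ x ∂(P.restrict A), False := by
    filter_upwards [h1, hf] with x hx hx'
    exact hx'.ne' hx
  have h3 : P A = 0 := by simpa [ae_iff] using h2
  simp [Measure.real, h3] at hA

lemma setIntegral_sub_const {P : Measure ℝ} [IsFiniteMeasure P] {A : Set ℝ} {m : ℝ}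
    (hx : Integrable (fun x : ℝ => x) P) (hm : ∫ x in A, x ∂P = P.real A * m) (k : ℝ) :
    ∫ x in A, (x - k) ∂P = P.real A * (m - k) := by
  rw [integral_sub hx.integrableOn (integrable_const k), hm]
  simp
  ring

lemma setIntegral_Iio_add_Ici {P : Measure ℝ} {f : ℝ → ℝ} (hf : Integrable f P) (c : ℝ) :
    ∫ x in Set.Iio c, f x ∂P + ∫ x in Set.Ici c, f x ∂P = ∫ x, f x ∂P := by
  rw [← Set.compl_Iio]
  exact integral_add_compl measurableSet_Iio hf

lemma setIntegral_Iio_add_Ico {P : Measure ℝ} {f : ℝ → ℝ} (hf : Integrable f P) {c e : ℝ}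
    (h : c ≤ e) :
    ∫ x in Set.Iio c, f x ∂P + ∫ x in Set.Ico c e, f x ∂P = ∫ x in Set.Iio e, f x ∂P := by
  rw [← Set.Iio_union_Ico_eq_Iio h, setIntegral_union _ measurableSet_Ico hf.integrableOn
    hf.integrableOn]
  exact Set.disjoint_left.2 fun x hx hx' => not_lt.2 hx'.1 hx

lemma setIntegral_Ico_add_Ici {P : Measure ℝ} {f : ℝ → ℝ} (hf : Integrable f P) {c e : ℝ}
    (h : c ≤ e) :
    ∫ x in Set.Ico c e, f x ∂P + ∫ x in Set.Ici e, f x ∂P = ∫ x in Set.Ici c, f x ∂P := by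
  rw [← Set.Ico_union_Ici_eq_Ici h, setIntegral_union _ measurableSet_Ici hf.integrableOn
    hf.integrableOn]
  exact Set.disjoint_left.2 fun x hx hx' => not_lt.2 hx' hx.2

/-- Under mean `μ` and mean absolute deviation `d`, the upper half-deviation is `d / 2`. -/
lemma setIntegral_Ici_of_mem_madSet {μ d : ℝ} {P : Measure ℝ} (hP : P ∈ madSet μ d) :
    ∫ x in Set.Ici μ, (x - μ) ∂P = d / 2 := by
  obtain ⟨hprob, hx, hmean, hmad⟩ := hP
  have hxm : Integrable (fun x : ℝ => x - μ) P := hx.sub (integrable_const μ)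
  have h0 : ∫ x, (x - μ) ∂P = 0 := by
    rw [integral_sub hx (integrable_const μ), hmean]; simp
  have h1 := setIntegral_Iio_add_Ici hxm μ
  have h2 := setIntegral_Iio_add_Ici hxm.abs μ
  have h3 : ∫ x in Set.Iio μ, |x - μ| ∂P = ∫ x in Set.Iio μ, -(x - μ) ∂P :=
    setIntegral_congr_fun measurableSet_Iio fun x hx => abs_of_neg (sub_neg.2 hx)
  have h4 : ∫ x in Set.Ici μ, |x - μ| ∂P = ∫ x in Set.Ici μ, (x - μ) ∂P :=
    setIntegral_congr_fun measurableSet_Ici fun x hx => abs_of_nonneg (sub_nonneg.2 hx)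
  rw [h3, h4, integral_neg, hmad] at h2
  rw [h0] at h1
  linarith

/-- Every measure in `madSet μ d` is dominated, for all functions concave on both sides of `t`, by a
two-point measure with mean `μ` and mean absolute deviation at most `d`. -/
lemma exists_twoPoint_jensen {μ d : ℝ} (hd : 0 < d) (t : ℝ) {P : Measure ℝ}
    (hP : P ∈ madSet μ d) :
    ∃ p q m1 m2 : ℝ, 0 < p ∧ 0 < q ∧ p + q = 1 ∧ p * m1 + q * m2 = μ ∧ m1 < μ ∧ μ < m2 ∧
      q * (m2 - μ) ≤ d / 2 ∧
      (q * (m2 - μ) = d / 2 ∨ t ≤ μ ∧ m1 < μ - d / 2 ∨ μ < t ∧ μ + d / 2 < m2) ∧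
      ∀ f : ℝ → ℝ, ConcaveOn ℝ (Set.Iio t) f → ConcaveOn ℝ (Set.Ici t) f → Integrable f P →
        ∫ x, f x ∂P ≤ p * f m1 + q * f m2 := by
  have hup := setIntegral_Ici_of_mem_madSet hP
  obtain ⟨hprob, hx, hmean, -⟩ := hP
  have hxk : ∀ k : ℝ, Integrable (fun x : ℝ => x - k) P := fun k => hx.sub (integrable_const k)
  have hxk' : ∀ k : ℝ, Integrable (fun x : ℝ => k - x) P := fun k => (integrable_const k).sub hx
  have hlow : ∫ x in Set.Iio μ, (x - μ) ∂P = -(d / 2) := by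
    have h0 : ∫ x, (x - μ) ∂P = 0 := by
      rw [integral_sub hx (integrable_const μ), hmean]; simp
    have h1 := setIntegral_Iio_add_Ici (hxk μ) μ
    linarith
  have hsum : ∀ c, P.real (Set.Iio c) + P.real (Set.Ici c) = 1 := fun c => by
    rw [← Set.compl_Iio]
    exact probReal_add_probReal_compl measurableSet_Iio
  have hposof : ∀ A : Set ℝ, ∫ x in A, (x - μ) ∂P ≠ 0 → 0 < P.real A := fun A h => by
    refine lt_of_le_of_ne measureReal_nonneg fun h0 => h ?_
    exact setIntegral_measure_zero _ ((measureReal_eq_zero_iff).1 h0.symm)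
  have hpμ : 0 < P.real (Set.Iio μ) := hposof _ (by rw [hlow]; linarith)
  have hqμ : 0 < P.real (Set.Ici μ) := hposof _ (by rw [hup]; linarith)
  have hbary : ∀ A : Set ℝ, 0 < P.real A → ∃ m, ∫ x in A, x ∂P = P.real A * m := fun A hA =>
    ⟨(∫ x in A, x ∂P) / P.real A, by field_simp⟩
  have hlt : ∀ (A : Set ℝ) (m c : ℝ), 0 < P.real A → ∫ x in A, x ∂P = P.real A * m →
      (∀ᵐ x ∂(P.restrict A), x < c) → m < c := fun A m c hA hm h => by
    have h1 : 0 < ∫ x in A, (c - x) ∂P :=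
      setIntegral_pos_of_ae hA (h.mono fun x hx => sub_pos.2 hx) (hxk' c).integrableOn
    have h2 : ∫ x in A, (c - x) ∂P = P.real A * (c - m) := by
      have := setIntegral_sub_const hx hm c
      rw [← neg_inj, ← integral_neg]
      simp only [neg_sub]
      rw [this]; ring
    rw [h2] at h1
    exact sub_pos.1 (pos_of_mul_pos_right h1 hA.le)
  have hge : ∀ (A : Set ℝ) (m c : ℝ), 0 < P.real A → ∫ x in A, x ∂P = P.real A * m →
      (∀ᵐ x ∂(P.restrict A), c ≤ x) → c ≤ m := fun A m c hA hm h => by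
    have h1 : 0 ≤ ∫ x in A, (x - c) ∂P :=
      integral_nonneg_of_ae (h.mono fun x hx => sub_nonneg.2 hx)
    rw [setIntegral_sub_const hx hm c] at h1
    exact sub_nonneg.1 (nonneg_of_mul_nonneg_right h1 hA)
  have hIio : ∀ c, ∀ᵐ x ∂(P.restrict (Set.Iio c)), x < c := fun c =>
    ae_restrict_mem measurableSet_Iio
  have hIci : ∀ c, ∀ᵐ x ∂(P.restrict (Set.Ici c)), c ≤ x := fun c =>
    ae_restrict_mem measurableSet_Ici
  have hint : ∀ m, t ≤ m → m ∈ interior (Set.Ici t) ∨ IsLeast (Set.Ici t) m := fun m h => by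
    rcases h.eq_or_lt with rfl | h
    · exact Or.inr isLeast_Ici
    · left; rwa [interior_Ici]
  have hint' : ∀ m, m < t → m ∈ interior (Set.Iio t) ∨ IsLeast (Set.Iio t) m := fun m h => by
    left; rwa [interior_Iio]
  have hmeans : ∀ c m1 m2, ∫ x in Set.Iio c, x ∂P = P.real (Set.Iio c) * m1 →
      ∫ x in Set.Ici c, x ∂P = P.real (Set.Ici c) * m2 →
      P.real (Set.Iio c) * m1 + P.real (Set.Ici c) * m2 = μ := fun c m1 m2 h1 h2 => by
    rw [← h1, ← h2, setIntegral_Iio_add_Ici hx c, hmean]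
  rcases le_or_gt t μ with htμ | htμ
  · rcases (measureReal_nonneg (μ := P) (s := Set.Iio t)).eq_or_lt with h0 | hp
    · obtain ⟨m1, hm1⟩ := hbary _ hpμ
      obtain ⟨m2, hm2⟩ := hbary _ hqμ
      have hm1μ := hlt _ m1 μ hpμ hm1 (hIio μ)
      have hMAD : P.real (Set.Ici μ) * (m2 - μ) = d / 2 := by
        rw [← hup, setIntegral_sub_const hx hm2]
      have hm2μ : μ < m2 := by
        refine sub_pos.1 (pos_of_mul_pos_right ?_ hqμ.le)
        rw [hMAD]; linarith
      have hae : ∀ᵐ x ∂P, t ≤ x := by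
        rw [ae_iff]
        simpa [Set.Iio] using (measureReal_eq_zero_iff).1 h0.symm
      have hae1 : ∀ A, ∀ᵐ x ∂(P.restrict A), x ∈ Set.Ici t := fun A => ae_restrict_of_ae hae
      refine ⟨_, _, m1, m2, hpμ, hqμ, hsum μ, hmeans μ m1 m2 hm1 hm2, hm1μ, hm2μ, hMAD.le,
        Or.inl hMAD, fun f _ hf hfi => ?_⟩
      rw [← setIntegral_Iio_add_Ici hfi μ]
      exact add_le_add
        (hf.setIntegral_le_measureReal_mul (hae1 _) hx.integrableOn hfi.integrableOn hm1
          (hint m1 (hge _ m1 t hpμ hm1 (hae1 _))))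
        (hf.setIntegral_le_measureReal_mul (hae1 _) hx.integrableOn hfi.integrableOn hm2
          (hint m2 (htμ.trans hm2μ.le)))
    · have hq : 0 < P.real (Set.Ici t) :=
        hqμ.trans_le (measureReal_mono (Set.Ici_subset_Ici.2 htμ))
      obtain ⟨m1, hm1⟩ := hbary _ hp
      obtain ⟨m2, hm2⟩ := hbary _ hq
      have hm1t := hlt _ m1 t hp hm1 (hIio t)
      have hm2t := hge _ m2 t hq hm2 (hIci t)
      have hmm := hmeans t m1 m2 hm1 hm2
      have hs := hsum t
      have hbal : P.real (Set.Iio t) * (μ - m1) = P.real (Set.Ici t) * (m2 - μ) := by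
        linear_combination μ * hs - hmm
      have hm1μ : m1 < μ - d / 2 := by
        rcases le_or_gt t (μ - d / 2) with h | h
        · linarith
        have h1 := setIntegral_Iio_add_Ico (hxk (μ - d / 2)) htμ
        have h2 : 0 ≤ ∫ x in Set.Ico t μ, (x - (μ - d / 2)) ∂P :=
          setIntegral_nonneg measurableSet_Ico fun x hx => by linarith [hx.1]
        have h3 : ∫ x in Set.Iio μ, (x - (μ - d / 2)) ∂P < 0 := by
          have : ∀ x : ℝ, x - (μ - d / 2) = (x - μ) + d / 2 := fun x => by ring
          simp_rw [this]
          rw [integral_add (hxk μ).integrableOn (integrable_const _), hlow]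
          simp only [integral_const, measureReal_restrict_apply_univ, smul_eq_mul]
          nlinarith [hsum μ]
        rw [setIntegral_sub_const hx hm1] at h1
        by_contra! h4
        have := mul_nonneg hp.le (sub_nonneg.2 h4)
        linarith
      have hm2μ : μ < m2 := by
        refine sub_pos.1 (pos_of_mul_pos_right ?_ hq.le)
        rw [← hbal]
        exact mul_pos hp (by linarith)
      have hMAD : P.real (Set.Ici t) * (m2 - μ) ≤ d / 2 := by
        rw [← hup, ← setIntegral_sub_const hx hm2, ← setIntegral_Ico_add_Ici (hxk μ) htμ]
        have : ∫ x in Set.Ico t μ, (x - μ) ∂P ≤ 0 :=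
          setIntegral_nonpos measurableSet_Ico fun x hx => by linarith [hx.2]
        linarith
      refine ⟨_, _, m1, m2, hp, hq, hs, hmm, by linarith, hm2μ, hMAD,
        Or.inr (Or.inl ⟨htμ, hm1μ⟩), fun f hf1 hf2 hfi => ?_⟩
      rw [← setIntegral_Iio_add_Ici hfi t]
      exact add_le_add
        (hf1.setIntegral_le_measureReal_mul (hIio t) hx.integrableOn hfi.integrableOn hm1
          (hint' m1 hm1t))
        (hf2.setIntegral_le_measureReal_mul (hIci t) hx.integrableOn hfi.integrableOn hm2
          (hint m2 hm2t))
  · rcases (measureReal_nonneg (μ := P) (s := Set.Ici t)).eq_or_lt with h0 | hq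
    · obtain ⟨m1, hm1⟩ := hbary _ hpμ
      obtain ⟨m2, hm2⟩ := hbary _ hqμ
      have hm1μ := hlt _ m1 μ hpμ hm1 (hIio μ)
      have hMAD : P.real (Set.Ici μ) * (m2 - μ) = d / 2 := by
        rw [← hup, setIntegral_sub_const hx hm2]
      have hm2μ : μ < m2 := by
        refine sub_pos.1 (pos_of_mul_pos_right ?_ hqμ.le)
        rw [hMAD]; linarith
      have hae : ∀ᵐ x ∂P, x < t := by
        rw [ae_iff]
        simpa [Set.Ici] using (measureReal_eq_zero_iff).1 h0.symm
      have hae1 : ∀ A, ∀ᵐ x ∂(P.restrict A), x ∈ Set.Iio t := fun A => ae_restrict_of_ae hae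
      refine ⟨_, _, m1, m2, hpμ, hqμ, hsum μ, hmeans μ m1 m2 hm1 hm2, hm1μ, hm2μ, hMAD.le,
        Or.inl hMAD, fun f hf _ hfi => ?_⟩
      rw [← setIntegral_Iio_add_Ici hfi μ]
      exact add_le_add
        (hf.setIntegral_le_measureReal_mul (hae1 _) hx.integrableOn hfi.integrableOn hm1
          (hint' m1 (hm1μ.trans htμ)))
        (hf.setIntegral_le_measureReal_mul (hae1 _) hx.integrableOn hfi.integrableOn hm2
          (hint' m2 (hlt _ m2 t hqμ hm2 (hae1 _))))
    · have hp : 0 < P.real (Set.Iio t) :=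
        hpμ.trans_le (measureReal_mono (Set.Iio_subset_Iio htμ.le))
      obtain ⟨m1, hm1⟩ := hbary _ hp
      obtain ⟨m2, hm2⟩ := hbary _ hq
      have hm1t := hlt _ m1 t hp hm1 (hIio t)
      have hm2t := hge _ m2 t hq hm2 (hIci t)
      have hmm := hmeans t m1 m2 hm1 hm2
      have hs := hsum t
      have hbal : P.real (Set.Iio t) * (μ - m1) = P.real (Set.Ici t) * (m2 - μ) := by
        linear_combination μ * hs - hmm
      have hm2μ : μ + d / 2 < m2 := by
        rcases lt_or_ge (μ + d / 2) t with h | h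
        · linarith
        have h1 := setIntegral_Ico_add_Ici (hxk (μ + d / 2)) htμ.le
        have h2 : ∫ x in Set.Ico μ t, (x - (μ + d / 2)) ∂P ≤ 0 :=
          setIntegral_nonpos measurableSet_Ico fun x hx => by linarith [hx.2]
        have h3 : 0 < ∫ x in Set.Ici μ, (x - (μ + d / 2)) ∂P := by
          have : ∀ x : ℝ, x - (μ + d / 2) = (x - μ) - d / 2 := fun x => by ring
          simp_rw [this]
          rw [integral_sub (hxk μ).integrableOn (integrable_const _), hup]
          simp only [integral_const, measureReal_restrict_apply_univ, smul_eq_mul]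
          nlinarith [hsum μ]
        rw [setIntegral_sub_const hx hm2] at h1
        by_contra! h4
        have := mul_nonneg hq.le (sub_nonneg.2 h4)
        linarith
      have hm1μ : m1 < μ := by
        refine sub_pos.1 (pos_of_mul_pos_right ?_ hp.le)
        rw [hbal]
        exact mul_pos hq (by linarith)
      have hMAD : P.real (Set.Ici t) * (m2 - μ) ≤ d / 2 := by
        rw [← hup, ← setIntegral_sub_const hx hm2, ← setIntegral_Ico_add_Ici (hxk μ) htμ.le]
        have : 0 ≤ ∫ x in Set.Ico μ t, (x - μ) ∂P :=
          setIntegral_nonneg measurableSet_Ico fun x hx => by linarith [hx.1]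
        linarith
      refine ⟨_, _, m1, m2, hp, hq, hs, hmm, hm1μ, by linarith, hMAD,
        Or.inr (Or.inr ⟨htμ, hm2μ⟩), fun f hf1 hf2 hfi => ?_⟩
      rw [← setIntegral_Iio_add_Ici hfi t]
      exact add_le_add
        (hf1.setIntegral_le_measureReal_mul (hIio t) hx.integrableOn hfi.integrableOn hm1
          (hint' m1 hm1t))
        (hf2.setIntegral_le_measureReal_mul (hIci t) hx.integrableOn hfi.integrableOn hm2
          (hint m2 hm2t))

lemma gfun_sub_add (μ : ℝ) (ψu ψl : ℝ → ℝ) {a b : ℝ} (ha : 0 < a) (hb : 0 < b) :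
    gfun μ ψu ψl (μ - a) (μ + b) =
      (b * ψu (μ - a) + a * ψu (μ + b)) / (b * ψl (μ - a) + a * ψl (μ + b)) := by
  have hab : a + b ≠ 0 := by positivity
  have h : ∀ f : ℝ → ℝ, (1 - a / (a + b)) * f (μ - a) + a / (a + b) * f (μ + b) =
      (b * f (μ - a) + a * f (μ + b)) / (a + b) := fun f => by field_simp; ring
  unfold gfun
  rw [show μ - (μ - a) = a by ring, show μ + b - (μ - a) = a + b by ring, h, h,
    div_div_div_cancel_right₀ hab]

lemma concaveOn_mul_add_right {s : Set ℝ} {f : ℝ → ℝ} (hf : ConcaveOn ℝ s f) {μ a : ℝ}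
    (hs : Set.Ioi μ ⊆ s) (ha : 0 ≤ a) (c : ℝ) :
    ConcaveOn ℝ (Set.Ioi 0) (fun b => b * c + a * f (μ + b)) := by
  refine ⟨convex_Ioi 0, fun x hx y hy u v hu hv huv => ?_⟩
  have h := hf.2 (hs (show μ < μ + x from lt_add_of_pos_right μ hx))
    (hs (show μ < μ + y from lt_add_of_pos_right μ hy)) hu hv huv
  simp only [smul_eq_mul] at h ⊢
  rw [show u * (μ + x) + v * (μ + y) = μ + (u * x + v * y) by linear_combination μ * huv] at h
  have := mul_le_mul_of_nonneg_left h ha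
  linarith

lemma concaveOn_mul_add_left {s : Set ℝ} {f : ℝ → ℝ} (hf : ConcaveOn ℝ s f) {μ b : ℝ}
    (hs : Set.Iio μ ⊆ s) (hb : 0 ≤ b) (c : ℝ) :
    ConcaveOn ℝ (Set.Ioi 0) (fun a => b * f (μ - a) + a * c) := by
  refine ⟨convex_Ioi 0, fun x hx y hy u v hu hv huv => ?_⟩
  have h := hf.2 (hs (show μ - x < μ from sub_lt_self μ hx))
    (hs (show μ - y < μ from sub_lt_self μ hy)) hu hv huv
  simp only [smul_eq_mul] at h ⊢
  rw [show u * (μ - x) + v * (μ - y) = μ - (u * x + v * y) by linear_combination μ * huv] at h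
  have := mul_le_mul_of_nonneg_left h hb
  linarith

lemma convexOn_mul_add_right {s : Set ℝ} {f : ℝ → ℝ} (hf : ConvexOn ℝ s f) {μ a : ℝ}
    (hs : Set.Ioi μ ⊆ s) (ha : 0 ≤ a) (c : ℝ) :
    ConvexOn ℝ (Set.Ioi 0) (fun b => b * c + a * f (μ + b)) := by
  refine (concaveOn_mul_add_right hf.neg hs ha (-c)).neg.congr fun x _ => ?_
  simp only [Pi.neg_apply]
  ring

lemma convexOn_mul_add_left {s : Set ℝ} {f : ℝ → ℝ} (hf : ConvexOn ℝ s f) {μ b : ℝ}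
    (hs : Set.Iio μ ⊆ s) (hb : 0 ≤ b) (c : ℝ) :
    ConvexOn ℝ (Set.Ioi 0) (fun a => b * f (μ - a) + a * c) := by
  refine (concaveOn_mul_add_left hf.neg hs hb (-c)).neg.congr fun x _ => ?_
  simp only [Pi.neg_apply]
  ring

lemma IsAffineOn.concaveOn {s : Set ℝ} {f : ℝ → ℝ} (hf : IsAffineOn f s) (hs : Convex ℝ s) :
    ConcaveOn ℝ s f := by
  obtain ⟨m, c, h⟩ := hf
  refine ⟨hs, fun x hx y hy u v hu hv huv => le_of_eq ?_⟩
  rw [h _ (hs hx hy hu hv huv), h x hx, h y hy]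
  simp only [smul_eq_mul]
  linear_combination c * huv

/-- The two-point measure on `μ - a` and `μ + b` with mean `μ` lies in `madSet μ d` when
`2 a b = d (a + b)`. -/
lemma twoPoint_sub_add_mem_madSet {μ d a b : ℝ} (ha : 0 < a) (hb : 0 < b)
    (hab : 2 * a * b = d * (a + b)) :
    twoPoint (μ - a) (b / (a + b)) (μ + b) (a / (a + b)) ∈ madSet μ d := by
  have hne : a + b ≠ 0 := by positivity
  refine twoPoint_mem_madSet (by positivity) (by positivity) (by field_simp; ring) (by linarith)
    (by linarith) (by field_simp; ring) ?_
  field_simp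
  linarith

/-- Every ratio over `madSet μ d` is dominated by the ratio of a two-point measure of `madSet μ d`,
provided its numerator is nonnegative or its denominator is piecewise affine. -/
lemma exists_twoPoint_ratio_ge {μ d t : ℝ} {ψu ψl : ℝ → ℝ} (hd : 0 < d)
    (hu₁ : ConcaveOn ℝ (Set.Iio t) ψu) (hu₂ : ConcaveOn ℝ (Set.Ici t) ψu)
    (hl₁ : ConvexOn ℝ (Set.Iio t) ψl) (hl₂ : ConvexOn ℝ (Set.Ici t) ψl)
    (hint : ∀ P ∈ madSet μ d, Integrable ψu P ∧ Integrable ψl P ∧ 0 < ∫ x, ψl x ∂P)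
    (hmono : ∀ v1 < μ - d / 2, MonotoneOn (fun v2 => gfun μ ψu ψl v1 v2) (Set.Ioi μ))
    (hanti : ∀ v2 > μ + d / 2, AntitoneOn (fun v1 => gfun μ ψu ψl v1 v2) (Set.Iio μ))
    {P : Measure ℝ} (hP : P ∈ madSet μ d)
    (hsign : 0 ≤ ∫ x, ψu x ∂P ∨ (IsAffineOn ψl (Set.Iio t) ∧ IsAffineOn ψl (Set.Ici t))) :
    ∃ v1 w1 v2 w2 : ℝ, v1 < μ - d / 2 ∧ μ + d / 2 < v2 ∧
      0 ≤ w1 ∧ 0 ≤ w2 ∧ w1 + w2 = 1 ∧ twoPoint v1 w1 v2 w2 ∈ madSet μ d ∧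
      (∫ x, ψu x ∂P) / (∫ x, ψl x ∂P) ≤
        (w1 * ψu v1 + w2 * ψu v2) / (w1 * ψl v1 + w2 * ψl v2) := by
  obtain ⟨hPu, hPl, hB0⟩ := hint P hP
  obtain ⟨p, q, m1, m2, hp, hq, hpq, hmean, hm1, hm2, hMAD, hcase, hJ⟩ :=
    exists_twoPoint_jensen hd t hP
  have hU := hJ ψu hu₁ hu₂ hPu
  have hV : p * ψl m1 + q * ψl m2 ≤ ∫ x, ψl x ∂P := by
    have := hJ (-ψl) hl₁.neg hl₂.neg hPl.neg
    simp only [Pi.neg_apply, integral_neg] at this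
    linarith
  have hsign' : 0 ≤ ∫ x, ψu x ∂P ∨ p * ψl m1 + q * ψl m2 = ∫ x, ψl x ∂P :=
    hsign.imp_right fun h => le_antisymm hV
      (hJ ψl (h.1.concaveOn (convex_Iio t)) (h.2.concaveOn (convex_Ici t)) hPl)
  obtain ⟨a, rfl⟩ : ∃ a, m1 = μ - a := ⟨μ - m1, by ring⟩
  obtain ⟨b, rfl⟩ : ∃ b, m2 = μ + b := ⟨m2 - μ, by ring⟩
  have ha : 0 < a := by linarith
  have hb : 0 < b := by linarith
  have hab : 0 < a + b := by linarith
  have hbal : p * a = q * b := by linear_combination μ * hpq - hmean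
  have hpe : (a + b) * p = b := by linear_combination hbal + b * hpq
  have hqe : (a + b) * q = a := by linear_combination a * hpq - hbal
  have hMAD : q * b ≤ d / 2 := by simpa using hMAD
  have hscale : ∀ f : ℝ → ℝ, b * f (μ - a) + a * f (μ + b) =
      (a + b) * (p * f (μ - a) + q * f (μ + b)) := fun f => by
    linear_combination -f (μ - a) * hpe - f (μ + b) * hqe
  have hratio : (∫ x, ψu x ∂P) / (∫ x, ψl x ∂P) =
      ((a + b) * ∫ x, ψu x ∂P) / ((a + b) * ∫ x, ψl x ∂P) := by
    rw [mul_div_mul_left _ _ hab.ne']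
  have hN : (a + b) * ∫ x, ψu x ∂P ≤ b * ψu (μ - a) + a * ψu (μ + b) := by
    rw [hscale]; gcongr
  have hD : b * ψl (μ - a) + a * ψl (μ + b) ≤ (a + b) * ∫ x, ψl x ∂P := by
    rw [hscale]; gcongr
  have hs : 0 ≤ (a + b) * ∫ x, ψu x ∂P ∨
      b * ψl (μ - a) + a * ψl (μ + b) = (a + b) * ∫ x, ψl x ∂P :=
    hsign'.imp (fun h => mul_nonneg hab.le h) fun h => by rw [hscale, h]
  have hMAD' : 2 * a * b ≤ d * (a + b) := by
    have := mul_le_mul_of_nonneg_left hMAD hab.le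
    rw [← mul_assoc, hqe] at this
    linarith
  have key : ∀ a' b' : ℝ, 0 < a' → 0 < b' → 2 * a' * b' = d * (a' + b') →
      (0 < b' * ψl (μ - a') + a' * ψl (μ + b') → (∫ x, ψu x ∂P) / (∫ x, ψl x ∂P) ≤
        (b' * ψu (μ - a') + a' * ψu (μ + b')) / (b' * ψl (μ - a') + a' * ψl (μ + b'))) →
      ∃ v1 w1 v2 w2 : ℝ, v1 < μ - d / 2 ∧ μ + d / 2 < v2 ∧
        0 ≤ w1 ∧ 0 ≤ w2 ∧ w1 + w2 = 1 ∧ twoPoint v1 w1 v2 w2 ∈ madSet μ d ∧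
        (∫ x, ψu x ∂P) / (∫ x, ψl x ∂P) ≤
          (w1 * ψu v1 + w2 * ψu v2) / (w1 * ψl v1 + w2 * ψl v2) := by
    intro a' b' ha' hb' h h'
    have hne : a' + b' ≠ 0 := by positivity
    have hmem := twoPoint_sub_add_mem_madSet (μ := μ) ha' hb' h
    have ha'd : d / 2 < a' := by nlinarith
    have hb'd : d / 2 < b' := by nlinarith
    have hw : ∀ f : ℝ → ℝ, b' / (a' + b') * f (μ - a') + a' / (a' + b') * f (μ + b') =
        (b' * f (μ - a') + a' * f (μ + b')) / (a' + b') := fun f => by field_simp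
    refine ⟨μ - a', b' / (a' + b'), μ + b', a' / (a' + b'), by linarith, by linarith,
      by positivity, by positivity, by field_simp; ring, hmem, ?_⟩
    have hpos := (hint _ hmem).2.2
    rw [integral_twoPoint ψl (by positivity) (by positivity), hw] at hpos
    rw [hw, hw, div_div_div_cancel_right₀ hne]
    exact h' ((div_pos_iff_of_pos_right (by positivity)).1 hpos)
  rcases hcase with h | ⟨ht, h⟩ | ⟨ht, h⟩
  · refine key a b ha hb ?_ fun hpos => ?_
    · have h : q * b = d / 2 := by simpa using h
      linear_combination 2 * (a + b) * h - 2 * b * hqe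
    · rw [hratio]
      rcases hs with hs | hs
      · exact div_le_div₀ (hs.trans hN) hN hpos hD
      · rw [← hs]; gcongr
  · have had : 0 < 2 * a - d := by linarith
    have hb₁ : 0 < d * a / (2 * a - d) := by positivity
    refine key a (d * a / (2 * a - d)) ha hb₁ (by field_simp; ring) fun hpos => ?_
    have hsub : Set.Ioi μ ⊆ Set.Ici t := fun x hx => ht.trans (le_of_lt hx)
    rw [hratio]
    refine div_le_div_of_monotoneOn (N := fun b => b * ψu (μ - a) + a * ψu (μ + b))
      (D := fun b => b * ψl (μ - a) + a * ψl (μ + b))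
      (concaveOn_mul_add_right hu₂ hsub ha.le _)
      (convexOn_mul_add_right hl₂ hsub ha.le _) ?_ hb ?_ hpos hN hD (mul_pos hab hB0) hs
    · intro x hx y hy hxy
      have := hmono (μ - a) h (show μ < μ + x from lt_add_of_pos_right μ hx)
        (show μ < μ + y from lt_add_of_pos_right μ hy) (by linarith)
      simpa only [gfun_sub_add μ ψu ψl ha hx, gfun_sub_add μ ψu ψl ha hy] using this
    · rw [le_div_iff₀ had]
      linarith
  · have hbd : 0 < 2 * b - d := by linarith
    have ha₁ : 0 < d * b / (2 * b - d) := by positivity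
    refine key (d * b / (2 * b - d)) b ha₁ hb (by field_simp; ring) fun hpos => ?_
    have hsub : Set.Iio μ ⊆ Set.Iio t := Set.Iio_subset_Iio ht.le
    rw [hratio]
    refine div_le_div_of_monotoneOn (N := fun a => b * ψu (μ - a) + a * ψu (μ + b))
      (D := fun a => b * ψl (μ - a) + a * ψl (μ + b))
      (concaveOn_mul_add_left hu₁ hsub hb.le _)
      (convexOn_mul_add_left hl₁ hsub hb.le _) ?_ ha ?_ hpos hN hD (mul_pos hab hB0) hs
    · intro x hx y hy hxy
      have := hanti (μ + b) h (show μ - y < μ from sub_lt_self μ hy)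
        (show μ - x < μ from sub_lt_self μ hx) (by linarith)
      simpa only [gfun_sub_add μ ψu ψl hx hb, gfun_sub_add μ ψu ψl hy hb] using this
    · rw [le_div_iff₀ hbd]
      linarith

/-- Reduction to two-point distributions for the mean-MAD ambiguity set. The suprema are taken in
the extended reals, so that unbounded problems are covered. -/
theorem stmt5 (μ d t : ℝ) (ψu ψl : ℝ → ℝ) (hd : 0 < d)
    (hψu_conc₁ : ConcaveOn ℝ (Set.Iio t) ψu) (hψu_mono₁ : MonotoneOn ψu (Set.Iio t))
    (hψu_conc₂ : ConcaveOn ℝ (Set.Ici t) ψu) (hψu_mono₂ : MonotoneOn ψu (Set.Ici t))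
    (hψl_conv₁ : ConvexOn ℝ (Set.Iio t) ψl) (hψl_anti₁ : AntitoneOn ψl (Set.Iio t))
    (hψl_conv₂ : ConvexOn ℝ (Set.Ici t) ψl) (hψl_anti₂ : AntitoneOn ψl (Set.Ici t))
    (hint : ∀ P ∈ madSet μ d, Integrable ψu P ∧ Integrable ψl P ∧ 0 < ∫ x, ψl x ∂P)
    (hsign : (∃ P ∈ madSet μ d, 0 ≤ ∫ x, ψu x ∂P) ∨
      (IsAffineOn ψl (Set.Iio t) ∧ IsAffineOn ψl (Set.Ici t)))
    (hmono : ∀ v1 < μ - d / 2, MonotoneOn (fun v2 => gfun μ ψu ψl v1 v2) (Set.Ioi μ))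
    (hanti : ∀ v2 > μ + d / 2, AntitoneOn (fun v1 => gfun μ ψu ψl v1 v2) (Set.Iio μ)) :
    sSup {y : EReal | ∃ P ∈ madSet μ d,
        y = (((∫ x, ψu x ∂P) / (∫ x, ψl x ∂P) : ℝ) : EReal)} =
    sSup {y : EReal | ∃ v1 w1 v2 w2 : ℝ, v1 < μ - d / 2 ∧ μ + d / 2 < v2 ∧
        0 ≤ w1 ∧ 0 ≤ w2 ∧ w1 + w2 = 1 ∧ twoPoint v1 w1 v2 w2 ∈ madSet μ d ∧
        y = (((w1 * ψu v1 + w2 * ψu v2) / (w1 * ψl v1 + w2 * ψl v2) : ℝ) : EReal)} := by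
  have hdom : ∀ P ∈ madSet μ d, ∃ v1 w1 v2 w2 : ℝ, v1 < μ - d / 2 ∧ μ + d / 2 < v2 ∧
      0 ≤ w1 ∧ 0 ≤ w2 ∧ w1 + w2 = 1 ∧ twoPoint v1 w1 v2 w2 ∈ madSet μ d ∧
      (∫ x, ψu x ∂P) / (∫ x, ψl x ∂P) ≤
        (w1 * ψu v1 + w2 * ψu v2) / (w1 * ψl v1 + w2 * ψl v2) := by
    intro P hP
    have hred := fun (Q : Measure ℝ) (hQ : Q ∈ madSet μ d) =>
      exists_twoPoint_ratio_ge (t := t) hd hψu_conc₁ hψu_conc₂ hψl_conv₁ hψl_conv₂ hint hmono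
        hanti hQ
    rcases hsign with ⟨P₀, hP₀, h₀⟩ | haff
    · rcases le_or_gt 0 (∫ x, ψu x ∂P) with h | h
      · exact hred P hP (Or.inl h)
      · obtain ⟨v1, w1, v2, w2, h1, h2, h3, h4, h5, h6, h7⟩ := hred P₀ hP₀ (Or.inl h₀)
        refine ⟨v1, w1, v2, w2, h1, h2, h3, h4, h5, h6, le_trans ?_ h7⟩
        exact (div_nonpos_of_nonpos_of_nonneg h.le (hint P hP).2.2.le).trans
          (div_nonneg h₀ (hint P₀ hP₀).2.2.le)
    · exact hred P hP (Or.inr haff)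
  apply le_antisymm
  · refine sSup_le ?_
    rintro y ⟨P, hP, rfl⟩
    obtain ⟨v1, w1, v2, w2, h1, h2, h3, h4, h5, h6, h7⟩ := hdom P hP
    exact (EReal.coe_le_coe_iff.2 h7).trans
      (le_sSup ⟨v1, w1, v2, w2, h1, h2, h3, h4, h5, h6, rfl⟩)
  · refine sSup_le_sSup ?_
    rintro y ⟨v1, w1, v2, w2, -, -, h3, h4, -, h6, rfl⟩
    exact ⟨_, h6, by rw [integral_twoPoint ψu h3 h4, integral_twoPoint ψl h3 h4]⟩
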